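/- arXiv:1102.3616 — 3 statements merged into one kernel-verified Lean document; each statement's English description precedes it below -/
import Mathlib

section
/- Consider the Gaussian regression model Y_i = f(X_i) + ε_i, i = 1, …, n, with ε_1, …, ε_n i.i.d. standard Gaussian and a deterministic design X_1, …, X_n ∈ [0,1]^d satisfying n⁻¹ Σ_{i=1}^n φ_k(X_i) φ_{k'}(X_i) ≤ n / N₁(d*,L)² for all distinct k, k' ∈ S_{(d*L)^{1/2}, d*}. Let γ* be the largest real number such that d* γ* is an integer and L ≥ γ* (1 + 1/(2 z_{γ*})). Fix α with 0 < α < (log 3 − log 2)/log 3 and suppose that ( (N₁(d*,γ*) − N₂(d*,γ*))² log C(d,d*) ) / ( n² N₁(d*,γ*) ) ≥ α/5, where C(d,d*) is the binomial coefficient. Then there exist a constant c > 0 and an integer d₀ (depending only on α and L) such that whenever d* ≥ d₀, every estimator J̃ (i.e., every measurable function of the data (Y₁, …, Yₙ) with values in the subsets of {1,…,d}) satisfies sup_{f ∈ Σ̃_L} P_f( J̃ ≠ J_f ) ≥ c. -/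
open Real Set MeasureTheory
open scoped Classical

/-- The unit cube `[0,1]^d`. -/
def unitBox (d : ℕ) : Set (Fin d → ℝ) := Set.univ.pi fun _ => Set.Icc (0 : ℝ) 1

/-- `k ∈ (ℤ^d)₊` : the first nonzero coordinate of `k` is positive. -/
def PosLex {d : ℕ} (k : Fin d → ℤ) : Prop :=
  ∃ j : Fin d, 0 < k j ∧ ∀ i : Fin d, i < j → k i = 0

/-- The Fourier basis on `[0,1]^d`: `φ_k(x) = 1` if `k = 0`,
`√2 cos(2π k·x)` if `k ∈ (ℤ^d)₊`, and `√2 sin(2π k·x)` if `−k ∈ (ℤ^d)₊`. -/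
noncomputable def phiF {d : ℕ} (k : Fin d → ℤ) (x : Fin d → ℝ) : ℝ :=
  if k = 0 then 1
  else if PosLex k then Real.sqrt 2 * Real.cos (2 * Real.pi * ∑ i, (k i : ℝ) * x i)
  else Real.sqrt 2 * Real.sin (2 * Real.pi * ∑ i, (k i : ℝ) * x i)

/-- The Fourier coefficient `θ_k[f] = ∫_{[0,1]^d} f(x) φ_k(x) dx`. -/
noncomputable def thetaCoef {d : ℕ} (f : (Fin d → ℝ) → ℝ) (k : Fin d → ℤ) : ℝ :=
  ∫ x in unitBox d, f x * phiF k x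

/-- `Q_j[f] = Σ_{k ∈ ℤ^d : k_j ≠ 0} θ_k[f]²`. -/
noncomputable def Qcoef {d : ℕ} (f : (Fin d → ℝ) → ℝ) (j : Fin d) : ℝ :=
  ∑' k : {k : Fin d → ℤ // k j ≠ 0}, thetaCoef f (k : Fin d → ℤ) ^ 2

/-- Membership in the smoothness class `Σ_L`:
for every `j`, `Σ_{k ∈ ℤ^d} k_j² θ_k[f]²` is finite and `≤ L`. -/
def memSigmaL {d : ℕ} (L : ℝ) (f : (Fin d → ℝ) → ℝ) : Prop :=
  ∀ j : Fin d, (Summable fun k : Fin d → ℤ => ((k j : ℝ)) ^ 2 * thetaCoef f k ^ 2) ∧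
    ∑' k : Fin d → ℤ, ((k j : ℝ)) ^ 2 * thetaCoef f k ^ 2 ≤ L

/-- The sparsity pattern `J_f = {j : Q_j[f] ≠ 0}` of a regression function `f`. -/
def sparsityPattern {d : ℕ} (f : (Fin d → ℝ) → ℝ) : Set (Fin d) :=
  {j : Fin d | Qcoef f j ≠ 0}

/-- Membership in the class `Σ̃_L` (with `κ = 1`): `f ∈ Σ_L`, the sparsity pattern `J_f`
has at most `d*` elements, `f` depends only on the coordinates in `J_f`, and
`Q_j[f] ≥ 1` for every `j ∈ J_f`. -/
def memTildeSigma {d : ℕ} (dstar : ℕ) (L : ℝ) (f : (Fin d → ℝ) → ℝ) : Prop :=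
  memSigmaL L f ∧ (sparsityPattern f).ncard ≤ dstar ∧
    (∀ x y : Fin d → ℝ, (∀ j ∈ sparsityPattern f, x j = y j) → f x = f y) ∧
    ∀ j ∈ sparsityPattern f, 1 ≤ Qcoef f j

/-- The standard Gaussian density `φ(t) = (2π)^{-1/2} e^{−t²/2}`. -/
noncomputable def gaussD (t : ℝ) : ℝ := (Real.sqrt (2 * Real.pi))⁻¹ * Real.exp (-(t ^ 2) / 2)

/-- `P_f`, the distribution on `ℝⁿ` of the observations `Y_i = f(X_i) + ε_i`,
`i = 1, …, n`, with i.i.d. standard Gaussian noise and fixed design `X`: the measure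
with density `y ↦ Π_i φ(y_i − f(X_i))` with respect to the Lebesgue measure. -/
noncomputable def Pf {d n : ℕ} (X : Fin n → Fin d → ℝ) (f : (Fin d → ℝ) → ℝ) :
    MeasureTheory.Measure (Fin n → ℝ) :=
  MeasureTheory.volume.withDensity
    (fun y => ENNReal.ofReal (∏ i, gaussD (y i - f (X i))))

/-- The Jacobi theta function `h(z) = Σ_{r ∈ ℤ} z^{r²}` for real `0 < z < 1`. -/
noncomputable def jacobiH (z : ℝ) : ℝ := ∑' r : ℤ, z ^ (r ^ 2).toNat

/-- `l_γ(z) = log h(z) − γ log z`. -/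
noncomputable def lgam (γ : ℝ) (z : ℝ) : ℝ := Real.log (jacobiH z) - γ * Real.log z

/-- `N₁(d*,γ) = #{k ∈ ℤ^{d*} : k₁² + … + k_{d*}² ≤ γ d*}`. -/
noncomputable def N1 (d : ℕ) (γ : ℝ) : ℕ :=
  Set.ncard {k : Fin d → ℤ | (∑ i, ((k i : ℝ)) ^ 2) ≤ γ * d}

/-- `N₂(d*,γ) = #{k ∈ ℤ^{d*} : k₁ = 0 and k₂² + … + k_{d*}² ≤ γ d*}`. -/
noncomputable def N2 (d : ℕ) (γ : ℝ) : ℕ :=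
  Set.ncard {k : Fin d → ℤ |
    (∀ i : Fin d, (i : ℕ) = 0 → k i = 0) ∧ (∑ i, ((k i : ℝ)) ^ 2) ≤ γ * d}

/-- `S_{m,ℓ} = {k ∈ ℤ^d : ‖k‖₂ ≤ m, ‖k‖₀ ≤ ℓ}`. -/
def sparseBall (d : ℕ) (m : ℝ) (ℓ : ℕ) : Set (Fin d → ℤ) :=
  {k : Fin d → ℤ | Real.sqrt (∑ i, ((k i : ℝ)) ^ 2) ≤ m ∧
    (Finset.univ.filter fun i => k i ≠ 0).card ≤ ℓ}

/-- Termwise-differentiated theta series, summable for `|z| < 1`. -/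
lemma summable_sq_mul_pow {z : ℝ} (hz : |z| < 1) :
    Summable fun r : ℤ => ((r ^ 2).toNat : ℝ) * z ^ (r ^ 2).toNat := by
  have h := summable_pow_mul_geometric_of_norm_lt_one (R := ℝ) 1 (r := z) (by simpa using hz)
  simp only [pow_one] at h
  have hnat : Summable fun m : ℕ => ((m ^ 2 : ℕ) : ℝ) * z ^ (m ^ 2) :=
    h.comp_injective (i := fun m : ℕ => m ^ 2) (Nat.pow_left_injective (by norm_num))
  have hcast : ∀ m : ℕ, (((m : ℤ)) ^ 2).toNat = m ^ 2 := fun m => by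
    rw [← Nat.cast_pow, Int.toNat_natCast]
  refine Summable.of_nat_of_neg ?_ ?_
  · simpa only [hcast] using hnat
  · simpa only [neg_sq, hcast] using hnat

lemma summable_jacobiH {z : ℝ} (hz : |z| < 1) :
    Summable fun r : ℤ => z ^ (r ^ 2).toNat := by
  have h := (summable_sq_mul_pow hz).norm
  have h0 : Summable fun r : ℤ => if r = 0 then (1 : ℝ) else 0 :=
    summable_of_hasFiniteSupport ((Set.finite_singleton (0 : ℤ)).subset fun r hr => by
      by_contra hne
      simp_all)
  refine Summable.of_norm_bounded (h.add h0) fun r => ?_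
  by_cases hr : r = 0
  · simp [hr]
  · have hpos : 0 < r ^ 2 := by positivity
    have h1 : (1 : ℝ) ≤ ((r ^ 2).toNat : ℝ) := by
      have : 1 ≤ (r ^ 2).toNat := by omega
      exact_mod_cast this
    simp only [hr, if_false, add_zero, norm_mul]
    have : (1 : ℝ) ≤ ‖((r ^ 2).toNat : ℝ)‖ := by rwa [Real.norm_of_nonneg (by positivity)]
    exact le_mul_of_one_le_left (norm_nonneg _) this

/-- The theta function is differentiable on `(0,1)`; its derivative `h'` satisfies `h' ≥ 2` and
`z h' ≥ h - 1`. -/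
lemma exists_hasDerivAt_jacobiH {z : ℝ} (hz : z ∈ Set.Ioo (0 : ℝ) 1) :
    ∃ h' : ℝ, HasDerivAt jacobiH h' z ∧ 2 ≤ h' ∧ jacobiH z - 1 ≤ z * h' := by
  obtain ⟨hz0, hz1⟩ := hz
  obtain ⟨ρ, hzρ, hρ1⟩ := exists_between hz1
  have hρ0 : 0 < ρ := hz0.trans hzρ
  have habs : |z| < 1 := by rwa [abs_of_pos hz0]
  have hρabs : |ρ| < 1 := by rwa [abs_of_pos hρ0]
  set g' : ℤ → ℝ → ℝ := fun r y => ((r ^ 2).toNat : ℝ) * y ^ ((r ^ 2).toNat - 1) with hg'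
  have hmul : ∀ (r : ℤ) (y : ℝ), y * g' r y = ((r ^ 2).toNat : ℝ) * y ^ (r ^ 2).toNat := by
    intro r y
    rcases Nat.eq_zero_or_pos (r ^ 2).toNat with h0 | h0
    · simp [hg', h0]
    · simp only [hg']
      rw [mul_left_comm, mul_pow_sub_one h0.ne']
  have hsum : ∀ y : ℝ, 0 < y → |y| < 1 → Summable fun r : ℤ => g' r y := by
    intro y hy hy1
    have := (summable_sq_mul_pow hy1).mul_left y⁻¹
    refine this.congr fun r => ?_
    rw [← hmul, inv_mul_cancel_left₀ hy.ne']
  have hder : HasDerivAt jacobiH (∑' r : ℤ, g' r z) z := by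
    refine hasDerivAt_tsum_of_isPreconnected (t := Set.Ioo 0 ρ) (u := fun r => g' r ρ)
      (g := fun (r : ℤ) y => y ^ (r ^ 2).toNat) (y₀ := z)
      (hsum ρ hρ0 hρabs) isOpen_Ioo isPreconnected_Ioo ?_ ?_ ⟨hz0, hzρ⟩ (summable_jacobiH habs)
      ⟨hz0, hzρ⟩
    · intro r y _
      exact hasDerivAt_pow _ _
    · intro r y hy
      have hy0 := hy.1
      have hyρ := hy.2.le
      simp only [hg']
      rw [Real.norm_of_nonneg (by positivity)]
      gcongr
  have hnn : ∀ r : ℤ, 0 ≤ g' r z := fun r => by simp only [hg']; positivity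
  refine ⟨_, hder, ?_, ?_⟩
  · have := (hsum z hz0 habs).sum_le_tsum {1, -1} (fun r _ => hnn r)
    rw [Finset.sum_pair (by norm_num)] at this
    simp only [hg'] at this ⊢
    norm_num at this
    linarith
  · rw [← tsum_mul_left]
    have h1 : Summable fun r : ℤ => z * g' r z := (hsum z hz0 habs).mul_left z
    have hs : HasSum (fun r : ℤ => if r = 0 then (1 : ℝ) else 0) 1 := by
      simpa using hasSum_ite_eq (0 : ℤ) (1 : ℝ)
    have h2 : jacobiH z ≤ ∑' r : ℤ, (z * g' r z + if r = 0 then (1 : ℝ) else 0) := by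
      refine (summable_jacobiH habs).tsum_le_tsum (fun r => ?_) (h1.add hs.summable)
      rw [hmul]
      by_cases hr : r = 0
      · simp [hr]
      · have hpos : 0 < r ^ 2 := by positivity
        have h1 : (1 : ℝ) ≤ ((r ^ 2).toNat : ℝ) := by
          have : 1 ≤ (r ^ 2).toNat := by omega
          exact_mod_cast this
        simp only [hr, if_false, add_zero]
        exact le_mul_of_one_le_left (by positivity) h1
    rw [h1.tsum_add hs.summable, hs.tsum_eq] at h2
    linarith

lemma one_le_jacobiH {z : ℝ} (hz : z ∈ Set.Ioo (0 : ℝ) 1) : 1 ≤ jacobiH z := by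
  have habs : |z| < 1 := by rw [abs_of_pos hz.1]; exact hz.2
  have := (summable_jacobiH habs).sum_le_tsum {0} (fun r _ => pow_nonneg hz.1.le _)
  simpa [jacobiH] using this

/-- At a critical point `z` of `l_γ`, the quantity `γ (1 + 1/(2z))` is at least `1` and exceeds `γ`
by at least `1/3`. -/
lemma critical_point_bounds {γ z : ℝ} (hz : z ∈ Set.Ioo (0 : ℝ) 1)
    (hd : deriv (lgam γ) z = 0) :
    1 ≤ γ * (1 + 1 / (2 * z)) ∧ γ + 1 / 3 ≤ γ * (1 + 1 / (2 * z)) := by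
  obtain ⟨h', hder, h2, h3⟩ := exists_hasDerivAt_jacobiH hz
  have hh := one_le_jacobiH hz
  have hz0 := hz.1
  have hz1 := hz.2
  set h := jacobiH z
  have hD : HasDerivAt (lgam γ) (h' / h - γ * z⁻¹) z :=
    (hder.log (by positivity)).sub ((Real.hasDerivAt_log hz0.ne').const_mul γ)
  rw [hD.deriv] at hd
  have hγ : γ = z * h' / h := by
    field_simp at hd ⊢
    linarith
  have hq : γ * (1 / (2 * z)) = h' / (2 * h) := by
    rw [hγ]; field_simp
  have hzh : z * h' ≤ h' := by nlinarith
  constructor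
  · rw [mul_add, hq, hγ, mul_one, div_add_div _ _ (by positivity) (by positivity),
      le_div_iff₀ (by positivity)]
    nlinarith
  · rw [mul_add, hq, mul_one]
    have : 1 / 3 ≤ h' / (2 * h) := by
      rw [div_le_div_iff₀ (by positivity) (by positivity)]
      linarith
    linarith

lemma finite_int_ball {D : ℕ} (c : ℝ) :
    {k : Fin D → ℤ | (∑ i, ((k i : ℝ)) ^ 2) ≤ c}.Finite := by
  refine (Set.Finite.pi (t := fun _ : Fin D => Set.Icc (-⌈c⌉) ⌈c⌉)
    fun _ => Set.finite_Icc _ _).subset fun k hk i _ => ?_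
  have h1 : ((k i : ℝ)) ^ 2 ≤ c :=
    (Finset.single_le_sum (f := fun i => ((k i : ℝ)) ^ 2) (fun i _ => sq_nonneg _)
      (Finset.mem_univ i)).trans hk
  have h2 : (k i) ^ 2 ≤ ⌈c⌉ := by
    have : (((k i) ^ 2 : ℤ) : ℝ) ≤ ⌈c⌉ := by push_cast; exact h1.trans (Int.le_ceil c)
    exact_mod_cast this
  constructor
  · nlinarith [Int.le_self_sq (-k i)]
  · nlinarith [Int.le_self_sq (k i)]

lemma N1_eq_card (D : ℕ) (γ : ℝ) :
    N1 D γ = (finite_int_ball (D := D) (γ * D)).toFinset.card :=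
  Set.ncard_eq_toFinset_card _ _

lemma one_le_N1 (D : ℕ) {γ : ℝ} (hγ : 0 ≤ γ) : 1 ≤ N1 D γ := by
  rw [N1_eq_card, Nat.one_le_iff_ne_zero, ← Nat.pos_iff_ne_zero, Finset.card_pos]
  refine ⟨0, ?_⟩
  simp only [Set.Finite.mem_toFinset, Set.mem_ofPred_eq, Pi.zero_apply, Int.cast_zero]
  simp
  positivity

lemma N2_le_N1 (D : ℕ) (γ : ℝ) : N2 D γ ≤ N1 D γ :=
  Set.ncard_le_ncard (fun _ hk => hk.2) (finite_int_ball _)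

/-- Enlarging the squared radius by `D/3` multiplies the number of lattice points of the ball by at
least `t² / (2L)`, as soon as the dimension `D` is large. -/
lemma sq_mul_N1_le {D : ℕ} {γ L : ℝ} (s t : ℕ) (hL : 0 < L) (hγL : γ + 1 / 3 ≤ L)
    (hs : 2 * L ≤ (s : ℝ) ^ 2) (ht : 0 < t) (hD : 3 * (2 * s + t) ^ 2 ≤ D) :
    (t : ℝ) ^ 2 * N1 D γ ≤ 2 * L * N1 D L := by
  have hD0 : 0 < D := by
    have : 0 < 3 * (2 * s + t) ^ 2 := by positivity
    omega
  have hDr : 3 * (2 * (s : ℝ) + t) ^ 2 ≤ D := by exact_mod_cast hD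
  have hD0r : (0 : ℝ) < D := by exact_mod_cast hD0
  have htr : (0 : ℝ) < t := by exact_mod_cast ht
  have hs0 : (0 : ℝ) < (s : ℝ) ^ 2 := by linarith
  rw [N1_eq_card, N1_eq_card]
  set C := (finite_int_ball (D := D) (γ * D)).toFinset with hC
  set C' := (finite_int_ball (D := D) (L * D)).toFinset with hC'
  have memC : ∀ k, k ∈ C ↔ (∑ i, ((k i : ℝ)) ^ 2) ≤ γ * D := fun k => by simp [hC]
  have memC' : ∀ k, k ∈ C' ↔ (∑ i, ((k i : ℝ)) ^ 2) ≤ L * D := fun k => by simp [hC']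
  have hinj : ∀ i : Fin D, (C.filter fun k => |k i| ≤ (s : ℤ)).card ≤
      (C'.filter fun k => (t : ℤ) ≤ |k i|).card := by
    intro i
    refine Finset.card_le_card_of_injOn (fun k => Function.update k i (k i + (s + t))) ?_ ?_
    · intro k hk
      simp only [Finset.coe_filter, Set.mem_ofPred_eq, memC, memC', Function.update_self] at hk ⊢
      obtain ⟨hk1, hk2⟩ := hk
      have hk3 := abs_le.mp hk2
      refine ⟨?_, ?_⟩
      · have e : ∑ j, ((Function.update k i (k i + (s + t)) j : ℤ) : ℝ) ^ 2 =
            ∑ j, ((k j : ℝ)) ^ 2 - (k i : ℝ) ^ 2 + ((k i : ℝ) + (s + t)) ^ 2 := by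
          rw [← Finset.add_sum_erase _ _ (Finset.mem_univ i),
            ← Finset.add_sum_erase (a := i) (f := fun j => ((k j : ℝ)) ^ 2) _ (Finset.mem_univ i)]
          have : ∑ j ∈ Finset.univ.erase i,
              ((Function.update k i (k i + (s + t)) j : ℤ) : ℝ) ^ 2 =
              ∑ j ∈ Finset.univ.erase i, ((k j : ℝ)) ^ 2 :=
            Finset.sum_congr rfl fun j hj => by
              rw [Function.update_of_ne (Finset.ne_of_mem_erase hj)]
          rw [this, Function.update_self]
          push_cast
          ring
        rw [e]
        have a1 : (k i : ℝ) ≤ s := by exact_mod_cast hk3.2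
        have a2 : -(s : ℝ) ≤ k i := by exact_mod_cast hk3.1
        have a3 : ((k i : ℝ) + (s + t)) ^ 2 ≤ (2 * s + t) ^ 2 :=
          pow_le_pow_left₀ (by linarith) (by linarith) 2
        nlinarith [sq_nonneg (k i : ℝ)]
      · exact le_trans (by linarith) (le_abs_self _)
    · intro k _ k' _ hkk
      funext j
      have hj := congrFun hkk j
      by_cases hji : j = i
      · subst hji
        simpa using hj
      · simpa [Function.update_of_ne hji] using hj
  have hlow : (C.card : ℝ) * (D / 2) ≤ ∑ i : Fin D, ((C.filter fun k => |k i| ≤ (s : ℤ)).card : ℝ) := by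
    simp_rw [Finset.card_filter, Nat.cast_sum]
    rw [Finset.sum_comm, ← nsmul_eq_mul]
    refine Finset.card_nsmul_le_sum _ _ _ fun k hk => ?_
    rw [memC] at hk
    calc (D : ℝ) / 2 ≤ D - (∑ i, ((k i : ℝ)) ^ 2) / (s : ℝ) ^ 2 := by
          have : (∑ i, ((k i : ℝ)) ^ 2) / (s : ℝ) ^ 2 ≤ D / 2 := by
            rw [div_le_iff₀ hs0]
            nlinarith
          linarith
      _ = ∑ i : Fin D, (1 - ((k i : ℝ)) ^ 2 / (s : ℝ) ^ 2) := by
          simp [Finset.sum_sub_distrib, Finset.sum_div]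
      _ ≤ _ := by
          refine Finset.sum_le_sum fun i _ => ?_
          split_ifs with h
          · have : 0 ≤ ((k i : ℝ)) ^ 2 / (s : ℝ) ^ 2 := by positivity
            push_cast; linarith
          · have h1 : (s : ℝ) ≤ |(k i : ℝ)| := by
              have := (not_le.mp h).le
              exact_mod_cast this
            have : 1 ≤ ((k i : ℝ)) ^ 2 / (s : ℝ) ^ 2 := by
              rw [one_le_div hs0, ← sq_abs (k i : ℝ)]
              gcongr
            push_cast; linarith
  have hup : ∑ i : Fin D, ((C'.filter fun k => (t : ℤ) ≤ |k i|).card : ℝ) ≤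
      (C'.card : ℝ) * (L * D / (t : ℝ) ^ 2) := by
    simp_rw [Finset.card_filter, Nat.cast_sum]
    rw [Finset.sum_comm, ← nsmul_eq_mul]
    refine Finset.sum_le_card_nsmul _ _ _ fun k hk => ?_
    rw [memC'] at hk
    calc _ ≤ ∑ i : Fin D, (((k i : ℝ)) ^ 2 / (t : ℝ) ^ 2) := by
          refine Finset.sum_le_sum fun i _ => ?_
          split_ifs with h
          · have h1 : (t : ℝ) ≤ |(k i : ℝ)| := by exact_mod_cast h
            rw [Nat.cast_one, one_le_div (by positivity), ← sq_abs (k i : ℝ)]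
            gcongr
          · rw [Nat.cast_zero]; positivity
      _ ≤ _ := by
          rw [← Finset.sum_div]
          gcongr
  have hmid : ∑ i : Fin D, ((C.filter fun k => |k i| ≤ (s : ℤ)).card : ℝ) ≤
      ∑ i : Fin D, ((C'.filter fun k => (t : ℤ) ≤ |k i|).card : ℝ) :=
    Finset.sum_le_sum fun i _ => by exact_mod_cast hinj i
  have := (hlow.trans hmid).trans hup
  rw [← mul_div_assoc _ (L * (D : ℝ)), le_div_iff₀ (by positivity)] at this
  have h2 : (D : ℝ) * ((t : ℝ) ^ 2 * C.card) ≤ D * (2 * L * C'.card) := by linarith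
  exact le_of_mul_le_mul_left h2 hD0r

lemma posLex_or_posLex_neg {d : ℕ} {k : Fin d → ℤ} (hk : k ≠ 0) : PosLex k ∨ PosLex (-k) := by
  obtain ⟨j₀, hj₀⟩ := Function.ne_iff.mp hk
  have hne : (Finset.univ.filter fun j => k j ≠ 0).Nonempty := ⟨j₀, by simpa using hj₀⟩
  set j := (Finset.univ.filter fun j => k j ≠ 0).min' hne with hj
  have hkj : k j ≠ 0 := by simpa using (Finset.min'_mem _ hne)
  have hlt : ∀ i, i < j → k i = 0 := by
    intro i hi
    by_contra hki
    exact absurd (Finset.min'_le _ i (by simpa using hki)) (not_le.mpr hi)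
  rcases lt_or_gt_of_ne hkj with h | h
  · exact Or.inr ⟨j, by simpa using h, fun i hi => by simp [hlt i hi]⟩
  · exact Or.inl ⟨j, h, hlt⟩

lemma PosLex.add {d : ℕ} {k l : Fin d → ℤ} (hk : PosLex k) (hl : PosLex l) : PosLex (k + l) := by
  obtain ⟨j, hj, hj'⟩ := hk
  obtain ⟨i, hi, hi'⟩ := hl
  rcases lt_trichotomy j i with h | h | h
  · exact ⟨j, by simpa [hi' j h] using hj, fun m hm => by simp [hj' m hm, hi' m (hm.trans h)]⟩
  · subst h
    exact ⟨j, by simpa using add_pos hj hi, fun m hm => by simp [hj' m hm, hi' m hm]⟩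
  · exact ⟨i, by simpa [hj' i h] using hi, fun m hm => by simp [hi' m hm, hj' m (hm.trans h)]⟩

lemma PosLex.ne_zero {d : ℕ} {k : Fin d → ℤ} (hk : PosLex k) : k ≠ 0 := by
  rintro rfl
  obtain ⟨j, hj, _⟩ := hk
  exact lt_irrefl _ hj

lemma PosLex.not_neg {d : ℕ} {k : Fin d → ℤ} (hk : PosLex k) : ¬ PosLex (-k) := fun h =>
  (hk.add h).ne_zero (add_neg_cancel k)

lemma phiF_of_posLex {d : ℕ} {k : Fin d → ℤ} (hk : PosLex k) (x : Fin d → ℝ) :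
    phiF k x = √2 * Real.cos (2 * π * ∑ i, (k i : ℝ) * x i) := by
  rw [phiF, if_neg hk.ne_zero, if_pos hk]

lemma phiF_neg_of_posLex {d : ℕ} {k : Fin d → ℤ} (hk : PosLex k) (x : Fin d → ℝ) :
    phiF (-k) x = -(√2 * Real.sin (2 * π * ∑ i, (k i : ℝ) * x i)) := by
  rw [phiF, if_neg (neg_ne_zero.mpr hk.ne_zero), if_neg hk.not_neg, ← mul_neg, ← Real.sin_neg]
  congr 2
  simp

lemma phiF_sq_add_phiF_neg_sq {d : ℕ} (k : Fin d → ℤ) (x : Fin d → ℝ) :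
    phiF k x ^ 2 + phiF (-k) x ^ 2 = 2 := by
  have key : ∀ l : Fin d → ℤ, PosLex l → phiF l x ^ 2 + phiF (-l) x ^ 2 = 2 := by
    intro l hl
    rw [phiF_of_posLex hl, phiF_neg_of_posLex hl, neg_sq, mul_pow, mul_pow, ← mul_add,
      Real.cos_sq_add_sin_sq, Real.sq_sqrt zero_le_two, mul_one]
  by_cases hk : k = 0
  · subst hk
    simp [phiF]
    norm_num
  · rcases posLex_or_posLex_neg hk with h | h
    · exact key k h
    · simpa [add_comm] using key _ h

lemma phiF_sq_le {d : ℕ} (k : Fin d → ℤ) (x : Fin d → ℝ) : phiF k x ^ 2 ≤ 2 := by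
  nlinarith [phiF_sq_add_phiF_neg_sq k x, sq_nonneg (phiF (-k) x)]

lemma sum_phiF_sq {d : ℕ} (T : Finset (Fin d → ℤ)) (hT : ∀ k ∈ T, -k ∈ T) (x : Fin d → ℝ) :
    ∑ k ∈ T, phiF k x ^ 2 = T.card := by
  have h : ∑ k ∈ T, phiF (-k) x ^ 2 = ∑ k ∈ T, phiF k x ^ 2 :=
    Finset.sum_nbij' (fun k => -k) (fun k => -k) hT hT (by simp) (by simp) (by simp)
  have h2 : ∑ k ∈ T, (phiF k x ^ 2 + phiF (-k) x ^ 2) = ∑ k ∈ T, (2 : ℝ) :=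
    Finset.sum_congr rfl fun k _ => phiF_sq_add_phiF_neg_sq k x
  rw [Finset.sum_add_distrib, h, Finset.sum_const, nsmul_eq_mul] at h2
  linarith

/-- A symmetric family of trigonometric functions whose pairwise empirical inner products are at
most `n / |T|²` has at most `5n` elements. -/
lemma card_le_of_near_orthogonal {d n : ℕ} (hn : 0 < n) (X : Fin n → Fin d → ℝ)
    (T : Finset (Fin d → ℤ)) (hT : ∀ k ∈ T, -k ∈ T)
    (horth : ∀ k ∈ T, ∀ k' ∈ T, k ≠ k' →
      (n : ℝ)⁻¹ * ∑ i, phiF k (X i) * phiF k' (X i) ≤ (n : ℝ) / (T.card : ℝ) ^ 2) :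
    (T.card : ℝ) ≤ 5 * n := by
  by_contra! hlt
  have hn' : (1 : ℝ) ≤ n := by exact_mod_cast hn
  set N : ℝ := (T.card : ℝ) with hN
  have hNpos : 0 < N := by linarith
  set G : (Fin d → ℤ) → (Fin d → ℤ) → ℝ := fun k k' => ∑ i, phiF k (X i) * phiF k' (X i) with hG
  set δ : ℝ := n ^ 2 / N ^ 2 with hδ
  have hδ0 : 0 ≤ δ := by positivity
  have hδn : δ ≤ 2 * n := by
    rw [hδ, div_le_iff₀ (by positivity)]
    nlinarith
  have hδN : δ * N ^ 2 = n ^ 2 := by rw [hδ]; field_simp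
  have hGδ : ∀ k ∈ T, ∀ k' ∈ T, k ≠ k' → G k k' ≤ δ := by
    intro k hk k' hk' hne
    have := horth k hk k' hk' hne
    rw [inv_mul_le_iff₀ (by linarith)] at this
    exact this.trans_eq (by rw [hδ]; ring)
  have hGabs : ∀ k k', |G k k'| ≤ 2 * n := by
    intro k k'
    refine (Finset.abs_sum_le_sum_abs _ _).trans ?_
    refine (Finset.sum_le_card_nsmul _ _ 2 fun i _ => ?_).trans_eq (by simp [mul_comm])
    rw [abs_le]
    have h1 := phiF_sq_le k (X i)
    have h2 := phiF_sq_le k' (X i)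
    constructor
    · nlinarith [sq_nonneg (phiF k (X i) + phiF k' (X i))]
    · nlinarith [sq_nonneg (phiF k (X i) - phiF k' (X i))]
  have hdiag : ∑ k ∈ T, G k k = n * N := by
    simp only [hG]
    rw [Finset.sum_comm]
    simp_rw [← pow_two, sum_phiF_sq T hT]
    simp [hN]
  have hpos : 0 ≤ ∑ k ∈ T, ∑ k' ∈ T, G k k' := by
    have : ∑ k ∈ T, ∑ k' ∈ T, G k k' = ∑ i, (∑ k ∈ T, phiF k (X i)) ^ 2 := by
      simp only [hG]
      simp_rw [pow_two, Finset.sum_mul_sum]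
      rw [Finset.sum_congr rfl fun k _ => Finset.sum_comm, Finset.sum_comm]
    rw [this]
    positivity
  have hupper : ∑ k ∈ T, ∑ k' ∈ T, G k k' ^ 2 ≤ 2 * n ^ 3 + 4 * n ^ 2 * N := by
    have hpt : ∀ k ∈ T, ∀ k' ∈ T, G k k' ^ 2 ≤
        2 * n * δ - (2 * n - δ) * G k k' + if k = k' then 4 * n * G k k' else 0 := by
      intro k hk k' hk'
      have hab := abs_le.mp (hGabs k k')
      split_ifs with h
      · subst h
        have h0 : 0 ≤ G k k := by
          simp only [hG]
          exact Finset.sum_nonneg fun i _ => mul_self_nonneg _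
        nlinarith
      · nlinarith [hGδ k hk k' hk' h]
    calc ∑ k ∈ T, ∑ k' ∈ T, G k k' ^ 2
        ≤ ∑ k ∈ T, ∑ k' ∈ T, (2 * n * δ - (2 * n - δ) * G k k' +
            if k = k' then 4 * n * G k k' else 0) :=
          Finset.sum_le_sum fun k hk => Finset.sum_le_sum fun k' hk' => hpt k hk k' hk'
      _ = N ^ 2 * (2 * n * δ) - (2 * n - δ) * ∑ k ∈ T, ∑ k' ∈ T, G k k' +
            4 * n * ∑ k ∈ T, G k k := by
          have hrow : ∀ k ∈ T, ∑ k' ∈ T, (2 * n * δ - (2 * n - δ) * G k k' +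
              if k = k' then 4 * n * G k k' else 0) =
              N * (2 * n * δ) - (2 * n - δ) * ∑ k' ∈ T, G k k' + 4 * n * G k k := by
            intro k hk
            rw [Finset.sum_add_distrib, Finset.sum_sub_distrib, Finset.sum_ite_eq, if_pos hk,
              Finset.sum_const, nsmul_eq_mul, ← Finset.mul_sum]
          rw [Finset.sum_congr rfl hrow, Finset.sum_add_distrib, Finset.sum_sub_distrib,
            Finset.sum_const, nsmul_eq_mul, ← Finset.mul_sum, ← Finset.mul_sum]
          ring
      _ ≤ _ := by
          rw [hdiag]
          nlinarith [mul_nonneg (sub_nonneg.mpr hδn) hpos]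
  have hlower : n * N ^ 2 ≤ ∑ k ∈ T, ∑ k' ∈ T, G k k' ^ 2 := by
    have hswap : ∑ k ∈ T, ∑ k' ∈ T, G k k' ^ 2 =
        ∑ i, ∑ i', (∑ k ∈ T, phiF k (X i) * phiF k (X i')) ^ 2 := by
      simp only [hG]
      simp_rw [pow_two, Finset.sum_mul_sum]
      rw [Finset.sum_congr rfl fun k _ => Finset.sum_comm, Finset.sum_comm]
      refine Finset.sum_congr rfl fun i _ => ?_
      rw [Finset.sum_congr rfl fun k _ => Finset.sum_comm, Finset.sum_comm]
      refine Finset.sum_congr rfl fun i' _ => ?_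
      refine Finset.sum_congr rfl fun k _ => Finset.sum_congr rfl fun k' _ => ?_
      ring
    rw [hswap]
    calc n * N ^ 2 = ∑ i : Fin n, (∑ k ∈ T, phiF k (X i) * phiF k (X i)) ^ 2 := by
          simp_rw [← pow_two, sum_phiF_sq T hT]
          simp [hN]
      _ ≤ _ := Finset.sum_le_sum fun i _ =>
          Finset.single_le_sum (f := fun i' => (∑ k ∈ T, phiF k (X i) * phiF k (X i')) ^ 2)
            (fun _ _ => sq_nonneg _) (Finset.mem_univ i)
  have h1 : n * N ^ 2 ≤ n * (2 * n ^ 2 + 4 * n * N) := by linarith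
  have h2 := le_of_mul_le_mul_left h1 (by linarith)
  nlinarith

/-- The near-orthogonality condition forces the sample size to be at least `N₁(d*,L) / 5`. -/
lemma N1_le_of_near_orthogonal {d D n : ℕ} (hD : D ≤ d) (hn : 0 < n) (X : Fin n → Fin d → ℝ)
    {L : ℝ} (horth : ∀ k ∈ sparseBall d (√(D * L)) D, ∀ k' ∈ sparseBall d (√(D * L)) D, k ≠ k' →
      (n : ℝ)⁻¹ * ∑ i, phiF k (X i) * phiF k' (X i) ≤ (n : ℝ) / (N1 D L : ℝ) ^ 2) :
    (N1 D L : ℝ) ≤ 5 * n := by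
  have hι := Fin.castLE_injective hD
  set e : (Fin D → ℤ) → (Fin d → ℤ) := fun k => Function.extend (Fin.castLE hD) k 0 with he
  have hinj : Function.Injective e := Function.extend_injective hι _
  have heval : ∀ k i, e k (Fin.castLE hD i) = k i := fun k i => hι.extend_apply _ _ _
  have hout : ∀ k j, j ∉ Set.range (Fin.castLE hD) → e k j = 0 := fun k j hj =>
    Function.extend_apply' _ _ _ hj
  set C := (finite_int_ball (D := D) (L * D)).toFinset with hC
  set T := C.image e with hT
  have hcard : T.card = N1 D L := by
    rw [hT, Finset.card_image_of_injective _ hinj, N1_eq_card]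
  have hmem : ∀ k ∈ T, k ∈ sparseBall d (√(D * L)) D := by
    intro k hk
    obtain ⟨l, hl, rfl⟩ := Finset.mem_image.mp hk
    have hl' : (∑ i, ((l i : ℝ)) ^ 2) ≤ L * D := by simpa [hC] using hl
    refine ⟨Real.sqrt_le_sqrt ?_, ?_⟩
    · have : ∑ i, ((l i : ℝ)) ^ 2 = ∑ j, ((e l j : ℝ)) ^ 2 :=
        Fintype.sum_of_injective _ hι (fun i => ((l i : ℝ)) ^ 2) (fun j => ((e l j : ℝ)) ^ 2)
          (fun j hj => by simp [hout l j hj]) (fun i => by rw [heval])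
      rw [← this]
      linarith
    · calc _ ≤ (Finset.univ.image (Fin.castLE hD)).card := by
            refine Finset.card_le_card fun j hj => ?_
            by_contra hj'
            exact (Finset.mem_filter.mp hj).2 (hout l j fun ⟨i, hi⟩ =>
              hj' (Finset.mem_image.mpr ⟨i, Finset.mem_univ i, hi⟩))
        _ ≤ D := Finset.card_image_le.trans (by simp)
  rw [← hcard]
  refine card_le_of_near_orthogonal hn X T ?_ ?_
  · intro k hk
    obtain ⟨l, hl, rfl⟩ := Finset.mem_image.mp hk
    refine Finset.mem_image.mpr ⟨-l, by simpa [hC] using hl, ?_⟩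
    funext j
    by_cases hj : j ∈ Set.range (Fin.castLE hD)
    · obtain ⟨i, rfl⟩ := hj
      simp [heval]
    · simp [hout _ j hj]
  · rw [hcard]
    exact fun k hk k' hk' => horth k (hmem k hk) k' (hmem k' hk')

lemma isCompact_unitBox (d : ℕ) : IsCompact (unitBox d) :=
  isCompact_univ_pi fun _ => isCompact_Icc

lemma integral_unitBox_exp {d : ℕ} (m : Fin d → ℤ) :
    ∫ x in unitBox d, Complex.exp ((2 * π * ∑ i, (m i : ℝ) * x i : ℝ) * Complex.I) =
      if m = 0 then 1 else 0 := by
  have h1 : ∀ x : Fin d → ℝ, Complex.exp ((2 * π * ∑ i, (m i : ℝ) * x i : ℝ) * Complex.I) =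
      ∏ i, Complex.exp ((2 * π * (m i) * Complex.I) * (x i : ℂ)) := by
    intro x
    rw [← Complex.exp_sum]
    congr 1
    push_cast
    rw [Finset.mul_sum, Finset.sum_mul]
    exact Finset.sum_congr rfl fun i _ => by ring
  have h2 : (volume : Measure (Fin d → ℝ)).restrict (unitBox d) =
      Measure.pi fun _ : Fin d => (volume : Measure ℝ).restrict (Set.Icc 0 1) := by
    rw [volume_pi, unitBox, Measure.restrict_pi_pi]
  have h3 : ∀ a : ℤ, ∫ t in Set.Icc (0 : ℝ) 1, Complex.exp ((2 * π * a * Complex.I) * (t : ℂ)) =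
      if a = 0 then 1 else 0 := by
    intro a
    rw [integral_Icc_eq_integral_Ioc, ← intervalIntegral.integral_of_le zero_le_one]
    split_ifs with ha
    · simp [ha]
    · have hne : (2 * π * a * Complex.I : ℂ) ≠ 0 := by
        simp [ha, Real.pi_ne_zero]
      rw [integral_exp_mul_complex hne]
      have : (2 * π * a * Complex.I : ℂ) * (1 : ℝ) = a * (2 * π * Complex.I) := by
        push_cast; ring
      rw [this, Complex.exp_int_mul_two_pi_mul_I]
      simp
  simp_rw [h1]
  rw [h2, integral_fintype_prod_eq_prod
    (f := fun i (t : ℝ) => Complex.exp ((2 * π * (m i) * Complex.I) * (t : ℂ)))]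
  simp_rw [h3]
  split_ifs with hm
  · simp [hm]
  · obtain ⟨j, hj⟩ := Function.ne_iff.mp hm
    exact Finset.prod_eq_zero (Finset.mem_univ j) (if_neg hj)

lemma integrableOn_unitBox {d : ℕ} {E : Type*} [NormedAddCommGroup E] {g : (Fin d → ℝ) → E}
    (hg : Continuous g) : IntegrableOn g (unitBox d) :=
  hg.continuousOn.integrableOn_compact (isCompact_unitBox d)

lemma integral_unitBox_cos {d : ℕ} (m : Fin d → ℤ) :
    ∫ x in unitBox d, Real.cos (2 * π * ∑ i, (m i : ℝ) * x i) = if m = 0 then 1 else 0 := by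
  have hi : IntegrableOn (fun x : Fin d → ℝ =>
      Complex.exp ((2 * π * ∑ i, (m i : ℝ) * x i : ℝ) * Complex.I)) (unitBox d) :=
    integrableOn_unitBox (by fun_prop)
  have h := Complex.reCLM.integral_comp_comm hi
  rw [integral_unitBox_exp] at h
  simp only [Complex.reCLM_apply, Complex.exp_ofReal_mul_I_re] at h
  rw [h]
  split_ifs <;> simp

lemma integral_unitBox_sin {d : ℕ} (m : Fin d → ℤ) :
    ∫ x in unitBox d, Real.sin (2 * π * ∑ i, (m i : ℝ) * x i) = 0 := by
  have hi : IntegrableOn (fun x : Fin d → ℝ =>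
      Complex.exp ((2 * π * ∑ i, (m i : ℝ) * x i : ℝ) * Complex.I)) (unitBox d) :=
    integrableOn_unitBox (by fun_prop)
  have h := Complex.imCLM.integral_comp_comm hi
  rw [integral_unitBox_exp] at h
  simp only [Complex.imCLM_apply, Complex.exp_ofReal_mul_I_im] at h
  rw [h]
  split_ifs <;> simp

/-- Fourier coefficients of a cosine basis function. -/
lemma thetaCoef_phiF {d : ℕ} {k : Fin d → ℤ} (hk : PosLex k) (l : Fin d → ℤ) :
    thetaCoef (phiF k) l = if l = k then 1 else 0 := by
  have hadd : ∀ (m m' : Fin d → ℤ) (x : Fin d → ℝ),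
      2 * π * ∑ i, (((m + m') i : ℤ) : ℝ) * x i =
        2 * π * ∑ i, (m i : ℝ) * x i + 2 * π * ∑ i, (m' i : ℝ) * x i := by
    intro m m' x
    rw [← mul_add, ← Finset.sum_add_distrib]
    congr 1
    exact Finset.sum_congr rfl fun i _ => by simp [add_mul]
  have hsub : ∀ (m m' : Fin d → ℤ) (x : Fin d → ℝ),
      2 * π * ∑ i, (((m - m') i : ℤ) : ℝ) * x i =
        2 * π * ∑ i, (m i : ℝ) * x i - 2 * π * ∑ i, (m' i : ℝ) * x i := by
    intro m m' x
    rw [← mul_sub, ← Finset.sum_sub_distrib]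
    congr 1
    exact Finset.sum_congr rfl fun i _ => by simp [sub_mul]
  have h2 : √2 * √2 = 2 := Real.mul_self_sqrt zero_le_two
  have hcos : ∀ m : Fin d → ℤ,
      IntegrableOn (fun x => Real.cos (2 * π * ∑ i, (m i : ℝ) * x i)) (unitBox d) :=
    fun m => integrableOn_unitBox (by fun_prop)
  have hsin : ∀ m : Fin d → ℤ,
      IntegrableOn (fun x => Real.sin (2 * π * ∑ i, (m i : ℝ) * x i)) (unitBox d) :=
    fun m => integrableOn_unitBox (by fun_prop)
  rw [thetaCoef]
  by_cases hl : l = 0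
  · subst hl
    rw [if_neg hk.ne_zero.symm]
    have : ∀ x, phiF k x * phiF 0 x = √2 * Real.cos (2 * π * ∑ i, (k i : ℝ) * x i) := by
      intro x
      rw [phiF_of_posLex hk]
      simp [phiF]
    simp_rw [this]
    rw [integral_const_mul, integral_unitBox_cos, if_neg hk.ne_zero, mul_zero]
  · rcases posLex_or_posLex_neg hl with hl | hl
    · have : ∀ x, phiF k x * phiF l x = Real.cos (2 * π * ∑ i, (((k - l) i : ℤ) : ℝ) * x i) +
          Real.cos (2 * π * ∑ i, (((k + l) i : ℤ) : ℝ) * x i) := by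
        intro x
        rw [phiF_of_posLex hk, phiF_of_posLex hl, hadd, hsub, Real.cos_add, Real.cos_sub]
        linear_combination (Real.cos (2 * π * ∑ i, (k i : ℝ) * x i) *
          Real.cos (2 * π * ∑ i, (l i : ℝ) * x i)) * h2
      simp_rw [this]
      rw [integral_add (hcos _) (hcos _), integral_unitBox_cos, integral_unitBox_cos,
        if_neg (hk.add hl).ne_zero, add_zero]
      simp only [sub_eq_zero, eq_comm]
    · have hne : l ≠ k := by
        rintro rfl
        exact hk.not_neg hl
      rw [if_neg hne]
      have : ∀ x, phiF k x * phiF l x =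
          Real.sin (2 * π * ∑ i, (((k - -l) i : ℤ) : ℝ) * x i) -
          Real.sin (2 * π * ∑ i, (((k + -l) i : ℤ) : ℝ) * x i) := by
        intro x
        have hl' := phiF_neg_of_posLex hl x
        rw [neg_neg] at hl'
        rw [phiF_of_posLex hk, hl', hadd, hsub, Real.sin_add, Real.sin_sub]
        linear_combination (-Real.cos (2 * π * ∑ i, (k i : ℝ) * x i) *
          Real.sin (2 * π * ∑ i, (((-l) i : ℤ) : ℝ) * x i)) * h2
      simp_rw [this]
      rw [integral_sub (hsin _) (hsin _), integral_unitBox_sin, integral_unitBox_sin, sub_zero]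

/-- Indicator frequency of a set of coordinates. -/
def indicatorFreq {d : ℕ} (J : Finset (Fin d)) : Fin d → ℤ := fun i => if i ∈ J then 1 else 0

lemma posLex_indicatorFreq {d : ℕ} {J : Finset (Fin d)} (hJ : J.Nonempty) :
    PosLex (indicatorFreq J) := by
  refine ⟨J.min' hJ, by simp [indicatorFreq, J.min'_mem hJ], fun i hi => ?_⟩
  exact if_neg fun hiJ => absurd (J.min'_le i hiJ) (not_le.mpr hi)

lemma sparsityPattern_phiF_indicatorFreq {d : ℕ} {J : Finset (Fin d)} (hJ : J.Nonempty) :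
    (∀ j ∈ J, Qcoef (phiF (indicatorFreq J)) j = 1) ∧
      sparsityPattern (phiF (indicatorFreq J)) = (J : Set (Fin d)) := by
  have hk := posLex_indicatorFreq hJ
  have h1 : ∀ j ∈ J, Qcoef (phiF (indicatorFreq J)) j = 1 := by
    intro j hj
    rw [Qcoef, tsum_eq_single ⟨indicatorFreq J, by simp [indicatorFreq, hj]⟩]
    · simp [thetaCoef_phiF hk]
    · intro l hl
      rw [thetaCoef_phiF hk, if_neg fun h => hl (Subtype.ext h)]
      norm_num
  refine ⟨h1, Set.ext fun j => ?_⟩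
  by_cases hj : j ∈ J
  · simp [sparsityPattern, h1 j hj, hj]
  · have : Qcoef (phiF (indicatorFreq J)) j = 0 := by
      rw [Qcoef]
      refine (tsum_congr fun l => ?_).trans tsum_zero
      rw [thetaCoef_phiF hk, if_neg]
      · norm_num
      · intro h
        apply l.2
        rw [h]
        exact if_neg hj
    simp [sparsityPattern, this, hj]

lemma memTildeSigma_phiF_indicatorFreq {d D : ℕ} {L : ℝ} (hL : 1 ≤ L) {J : Finset (Fin d)}
    (hJ : J.Nonempty) (hcard : J.card = D) :
    memTildeSigma D L (phiF (indicatorFreq J)) := by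
  have hk := posLex_indicatorFreq hJ
  obtain ⟨hQ, hpat⟩ := sparsityPattern_phiF_indicatorFreq hJ
  refine ⟨fun j => ?_, ?_, ?_, ?_⟩
  · have hs : HasSum (fun k : Fin d → ℤ => ((k j : ℝ)) ^ 2 *
        thetaCoef (phiF (indicatorFreq J)) k ^ 2) ((indicatorFreq J j : ℝ) ^ 2) := by
      have := hasSum_single (f := fun k : Fin d → ℤ => ((k j : ℝ)) ^ 2 *
        thetaCoef (phiF (indicatorFreq J)) k ^ 2) (indicatorFreq J)
        (fun l hl => by rw [thetaCoef_phiF hk, if_neg hl]; ring)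
      simpa [thetaCoef_phiF hk] using this
    refine ⟨hs.summable, hs.tsum_eq.trans_le (le_trans ?_ hL)⟩
    simp only [indicatorFreq]
    split_ifs <;> norm_num
  · rw [hpat, Set.ncard_coe_finset, hcard]
  · rw [hpat]
    intro x y hxy
    rw [phiF_of_posLex hk, phiF_of_posLex hk]
    congr 3
    refine Finset.sum_congr rfl fun i _ => ?_
    by_cases hi : i ∈ J
    · rw [hxy i hi]
    · simp [indicatorFreq, hi]
  · rw [hpat]
    exact fun j hj => (hQ j hj).ge

lemma gaussD_pos (t : ℝ) : 0 < gaussD t := by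
  unfold gaussD
  positivity

@[fun_prop]
lemma continuous_gaussD : Continuous gaussD := by
  unfold gaussD
  fun_prop

lemma gaussD_sub_eq (a t : ℝ) :
    gaussD (t - a) = ProbabilityTheory.gaussianPDFReal a 1 t := by
  simp [gaussD, ProbabilityTheory.gaussianPDFReal]

lemma isProbabilityMeasure_Pf {d n : ℕ} (X : Fin n → Fin d → ℝ) (f : (Fin d → ℝ) → ℝ) :
    IsProbabilityMeasure (Pf X f) := by
  constructor
  have hint : Integrable fun y : Fin n → ℝ => ∏ i, gaussD (y i - f (X i)) := by
    simp_rw [gaussD_sub_eq]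
    exact Integrable.fintype_prod fun i => ProbabilityTheory.integrable_gaussianPDFReal _ _
  rw [Pf, withDensity_apply _ MeasurableSet.univ, Measure.restrict_univ,
    ← ofReal_integral_eq_lintegral_ofReal hint
      (Filter.Eventually.of_forall fun y => Finset.prod_nonneg fun i _ => (gaussD_pos _).le)]
  simp_rw [gaussD_sub_eq]
  rw [integral_fintype_prod_volume_eq_prod
    (f := fun i t => ProbabilityTheory.gaussianPDFReal (f (X i)) 1 t)]
  simp [ProbabilityTheory.integral_gaussianPDFReal_eq_one]

lemma gaussD_sq (a t : ℝ) :
    gaussD (t - a) ^ 2 = Real.exp (a ^ 2) * (gaussD (t - 2 * a) * gaussD (t - 0)) := by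
  simp only [gaussD]
  rw [mul_pow, ← Real.exp_nat_mul, mul_mul_mul_comm, ← pow_two, ← Real.exp_add, mul_left_comm,
    ← Real.exp_add]
  congr 2
  push_cast
  ring

/-- Change of measure: the law `P_f` is dominated by a combination of `P_{2f}` and `P_0`. -/
lemma Pf_le {d n : ℕ} (X : Fin n → Fin d → ℝ) (f : (Fin d → ℝ) → ℝ) {ε : ℝ} (hε : 0 < ε)
    {B : Set (Fin n → ℝ)} (hB : MeasurableSet B) :
    Pf X f B ≤ ENNReal.ofReal (ε / 2 * Real.exp (∑ i, f (X i) ^ 2)) * Pf X (2 * f) B +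
      ENNReal.ofReal (1 / (2 * ε)) * Pf X 0 B := by
  have hmeas : ∀ g : (Fin d → ℝ) → ℝ, Measurable fun y : Fin n → ℝ =>
      ENNReal.ofReal (∏ i, gaussD (y i - g (X i))) := fun g => by
    refine (Continuous.measurable ?_).ennreal_ofReal
    fun_prop
  simp only [Pf]
  rw [withDensity_apply _ hB, withDensity_apply _ hB, withDensity_apply _ hB,
    ← lintegral_const_mul _ (hmeas _), ← lintegral_const_mul _ (hmeas _),
    ← lintegral_add_left ((hmeas _).const_mul _)]
  refine lintegral_mono fun y => ?_
  simp only [Pi.mul_apply, Pi.ofNat_apply]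
  have hnn : ∀ g : Fin n → ℝ, 0 ≤ ∏ i, gaussD (y i - g i) := fun g =>
    Finset.prod_nonneg fun i _ => (gaussD_pos _).le
  have h2 := hnn fun i => 2 * f (X i)
  have h0 := hnn fun _ => 0
  have h1 := hnn fun i => f (X i)
  rw [← ENNReal.ofReal_mul (by positivity), ← ENNReal.ofReal_mul (by positivity),
    ← ENNReal.ofReal_add (by positivity) (by positivity)]
  apply ENNReal.ofReal_le_ofReal
  have hsq : (∏ i, gaussD (y i - f (X i))) ^ 2 = Real.exp (∑ i, f (X i) ^ 2) *
      ((∏ i, gaussD (y i - 2 * f (X i))) * ∏ i, gaussD (y i - 0)) := by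
    rw [← Finset.prod_pow, Real.exp_sum, ← Finset.prod_mul_distrib, ← Finset.prod_mul_distrib]
    exact Finset.prod_congr rfl fun i _ => gaussD_sq _ _
  set p := ∏ i, gaussD (y i - f (X i))
  set q := ∏ i, gaussD (y i - 2 * f (X i))
  set r := ∏ i, gaussD (y i - 0)
  set E := Real.exp (∑ i, f (X i) ^ 2)
  have hE : 0 < E := Real.exp_pos _
  refine abs_le_of_sq_le_sq' ?_ (by positivity) |>.2
  rw [hsq]
  have : (ε / 2 * E * q + 1 / (2 * ε) * r) ^ 2 - E * (q * r) =
      (ε / 2 * E * q - 1 / (2 * ε) * r) ^ 2 := by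
    field_simp
    ring
  nlinarith [sq_nonneg (ε / 2 * E * q - 1 / (2 * ε) * r)]

/-- Lower bound for testing many hypotheses: if each of the `M` distinct patterns is realised by a
regression function whose squared empirical norm is at most `(log M) / 2`, no estimator, measurable
or not, recovers all patterns with probability above `3/4`. -/
lemma exists_error_ge {d n : ℕ} (X : Fin n → Fin d → ℝ) (S : Finset (Finset (Fin d)))
    (f : Finset (Fin d) → (Fin d → ℝ) → ℝ) (hS : 16 ≤ S.card)
    (hf : ∀ J ∈ S, ∑ i, f J (X i) ^ 2 ≤ Real.log S.card / 2)
    (Jest : (Fin n → ℝ) → Set (Fin d)) :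
    ∃ J ∈ S, ENNReal.ofReal (1 / 4) ≤ Pf X (f J) {y | Jest y ≠ (J : Set (Fin d))} := by
  by_contra! hcon
  have hM : (16 : ℝ) ≤ S.card := by exact_mod_cast hS
  set M : ℝ := (S.card : ℝ) with hMdef
  have hsqrt : 4 ≤ √M := Real.le_sqrt_of_sq_le (by linarith)
  have hMM : √M * √M = M := Real.mul_self_sqrt (by linarith)
  set A : Finset (Fin d) → Set (Fin n → ℝ) := fun J =>
    toMeasurable (Pf X (f J)) {y | Jest y ≠ (J : Set (Fin d))} with hA
  have hAm : ∀ J, MeasurableSet (A J) := fun J => measurableSet_toMeasurable _ _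
  have hsub : ∀ J, (A J)ᶜ ⊆ {y | Jest y = (J : Set (Fin d))} := by
    intro J y hy
    by_contra hne
    exact hy (subset_toMeasurable _ _ hne)
  have hdisj : (S : Set (Finset (Fin d))).PairwiseDisjoint fun J => (A J)ᶜ := by
    intro J _ J' _ hne
    refine Set.disjoint_left.mpr fun y hy hy' => hne ?_
    exact Finset.coe_injective ((hsub J hy).symm.trans (hsub J' hy'))
  have hP0 := isProbabilityMeasure_Pf X 0
  have hsum : ∑ J ∈ S, (Pf X 0).real ((A J)ᶜ) ≤ 1 := by
    rw [← measureReal_biUnion_finset hdisj fun J _ => (hAm J).compl]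
    exact measureReal_le_one
  have hSne : S.Nonempty := Finset.card_pos.mp (by omega)
  obtain ⟨J, hJ, hJle⟩ : ∃ J ∈ S, (Pf X 0).real ((A J)ᶜ) ≤ 1 / M := by
    refine Finset.exists_le_of_sum_le hSne (hsum.trans_eq ?_)
    rw [Finset.sum_const, nsmul_eq_mul, ← hMdef]
    field_simp
  have hPJ := isProbabilityMeasure_Pf X (f J)
  have hP2 := isProbabilityMeasure_Pf X (2 * f J)
  have hupper : (Pf X (f J)).real ((A J)ᶜ) ≤ 5 / 8 := by
    have h := Pf_le X (f J) (ε := 1 / √M) (by positivity) (hAm J).compl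
    have h' := ENNReal.toReal_mono (by finiteness) h
    rw [ENNReal.toReal_add (by finiteness) (by finiteness), ENNReal.toReal_mul, ENNReal.toReal_mul,
      ENNReal.toReal_ofReal (by positivity), ENNReal.toReal_ofReal (by positivity)] at h'
    have hexp : Real.exp (∑ i, f J (X i) ^ 2) ≤ √M := by
      refine (Real.exp_le_exp.mpr (hf J hJ)).trans_eq ?_
      rw [← Real.log_sqrt (by linarith), Real.exp_log (by linarith)]
    have hq : (Pf X (2 * f J)).real ((A J)ᶜ) ≤ 1 := measureReal_le_one
    have hq0 : 0 ≤ (Pf X (2 * f J)).real ((A J)ᶜ) := measureReal_nonneg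
    simp only [Measure.real] at hq hq0 hJle ⊢
    calc _ ≤ _ := h'
      _ ≤ 1 / √M / 2 * √M * 1 + 1 / (2 * (1 / √M)) * (1 / M) := by gcongr
      _ = 1 / 2 + 1 / (2 * √M) := by
          nth_rewrite 4 [← hMM]
          field_simp
      _ ≤ 1 / 2 + 1 / (2 * 4) := by gcongr
      _ = 5 / 8 := by norm_num
  have hlower : (Pf X (f J)).real (A J) < 1 / 4 := by
    rw [Measure.real, hA, measure_toMeasurable]
    refine ENNReal.toReal_lt_of_lt_ofReal ?_
    exact hcon J hJ
  have := probReal_compl_eq_one_sub (μ := Pf X (f J)) (hAm J)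
  linarith

/-- Theorem 2 of the paper. Fix `α ∈ (0, (log 3 − log 2)/log 3)` and
`L > 0`, and let `γ ↦ z_γ` select the unique root in `(0,1)` of `l_γ'`.  There are
`c > 0` and `d₀ ∈ ℕ`, depending only on `α` and `L`, such that: for every Gaussian
regression problem with deterministic design `X_1, …, X_n ∈ [0,1]^d` satisfying the
near-orthogonality condition `n⁻¹ Σ_i φ_k(X_i) φ_{k'}(X_i) ≤ n/N₁(d*,L)²` for all
distinct `k, k' ∈ S_{√(d*L),d*}`, if `γ*` is the largest real such that `d* γ*` is an
integer and `L ≥ γ*(1 + 1/(2 z_{γ*}))`, if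
`(N₁(d*,γ*) − N₂(d*,γ*))² log C(d,d*) / (n² N₁(d*,γ*)) ≥ α/5`, and if `d* ≥ d₀`, then
every estimator `J̃ : ℝⁿ → 2^{1,…,d}` satisfies `sup_{f ∈ Σ̃_L} P_f(J̃ ≠ J_f) ≥ c`. -/
theorem sparsity_pattern_lower_bound_increasing_sparsity (α L : ℝ) (hL : 0 < L)
    (hα : 0 < α ∧ α < (Real.log 3 - Real.log 2) / Real.log 3)
    (zsel : ℝ → ℝ)
    (hzsel : ∀ γ : ℝ, 0 < γ →
      zsel γ ∈ Set.Ioo (0 : ℝ) 1 ∧ deriv (lgam γ) (zsel γ) = 0) :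
    ∃ c : ℝ, 0 < c ∧ ∃ d₀ : ℕ,
      ∀ (d dstar n : ℕ) (X : Fin n → Fin d → ℝ) (γstar : ℝ),
        1 ≤ dstar → dstar ≤ d → 0 < n → (∀ i, X i ∈ unitBox d) →
        -- the design satisfies condition (orth)
        (∀ k ∈ sparseBall d (Real.sqrt (dstar * L)) dstar,
          ∀ k' ∈ sparseBall d (Real.sqrt (dstar * L)) dstar, k ≠ k' →
            (n : ℝ)⁻¹ * ∑ i, phiF k (X i) * phiF k' (X i)
              ≤ (n : ℝ) / (N1 dstar L : ℝ) ^ 2) →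
        -- `γ*` is the largest real number with `d* γ* ∈ ℤ` and `L ≥ γ*(1 + 1/(2 z_{γ*}))`
        (0 < γstar ∧ (∃ m : ℤ, γstar * dstar = (m : ℝ)) ∧
          γstar * (1 + 1 / (2 * zsel γstar)) ≤ L ∧
          ∀ γ' : ℝ, 0 < γ' → (∃ m : ℤ, γ' * dstar = (m : ℝ)) →
            γ' * (1 + 1 / (2 * zsel γ')) ≤ L → γ' ≤ γstar) →
        -- the main condition (10) of Theorem 2
        α / 5 ≤ ((N1 dstar γstar : ℝ) - (N2 dstar γstar : ℝ)) ^ 2 *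
            Real.log (d.choose dstar) / ((n : ℝ) ^ 2 * (N1 dstar γstar : ℝ)) →
        d₀ ≤ dstar →
        ∀ Jest : (Fin n → ℝ) → Set (Fin d),
          ∃ f : (Fin d → ℝ) → ℝ, memTildeSigma dstar L f ∧
            ENNReal.ofReal c ≤ Pf X f {y : Fin n → ℝ | Jest y ≠ sparsityPattern f} := by
  obtain ⟨hα0, -⟩ := hα
  set s : ℕ := ⌈2 * L⌉₊ + 1 with hs_def
  set t : ℕ := ⌈200 * L / α⌉₊ + 1 with ht_def
  have hs : 2 * L ≤ (s : ℝ) ^ 2 := by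
    have h1 : 2 * L ≤ (⌈2 * L⌉₊ : ℝ) := Nat.le_ceil _
    rw [hs_def]
    push_cast
    nlinarith
  have ht : 200 * L / α ≤ (t : ℝ) ^ 2 := by
    have h1 : 200 * L / α ≤ (⌈200 * L / α⌉₊ : ℝ) := Nat.le_ceil _
    have h2 : 0 ≤ 200 * L / α := by positivity
    rw [ht_def]
    push_cast
    nlinarith
  refine ⟨1 / 4, by norm_num, 3 * (2 * s + t) ^ 2, ?_⟩
  intro d D n X γ hD1 hDd hn _ horth hγ hcond hd0 Jest
  obtain ⟨hγ0, -, hγL, -⟩ := hγ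
  obtain ⟨hz, hdz⟩ := hzsel γ hγ0
  obtain ⟨h1L, hgap⟩ := critical_point_bounds hz hdz
  have hgrow := sq_mul_N1_le s t hL (hgap.trans hγL) hs (by omega) hd0
  have hcount := N1_le_of_near_orthogonal hDd hn X horth
  have hnr : (1 : ℝ) ≤ n := by exact_mod_cast hn
  have hN1 : (1 : ℝ) ≤ N1 D γ := by exact_mod_cast one_le_N1 D hγ0.le
  have hN2 : (N2 D γ : ℝ) ≤ N1 D γ := by exact_mod_cast N2_le_N1 D γ
  have hN2' : (0 : ℝ) ≤ N2 D γ := Nat.cast_nonneg _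
  set N : ℝ := (N1 D γ : ℝ)
  have hsize : 20 * N ≤ α * n := by
    have h1 : 200 * L / α * N ≤ 2 * L * (5 * n) :=
      ((mul_le_mul_of_nonneg_right ht (by linarith)).trans hgrow).trans (by gcongr)
    rw [div_mul_eq_mul_div, div_le_iff₀ hα0] at h1
    have h2 : (10 * L) * (20 * N) ≤ (10 * L) * (α * n) := by linarith
    exact le_of_mul_le_mul_left h2 (by positivity)
  have hlog0 : 0 ≤ Real.log (d.choose D) := Real.log_natCast_nonneg _
  have hlog : 4 * (n : ℝ) ≤ Real.log (d.choose D) := by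
    rw [le_div_iff₀ (by positivity)] at hcond
    have h1 : (N - N2 D γ) ^ 2 * Real.log (d.choose D) ≤ N ^ 2 * Real.log (d.choose D) := by
      gcongr
      linarith
    have h2 : N * (α * n ^ 2) ≤ N * (5 * N * Real.log (d.choose D)) := by linarith
    have h3 := le_of_mul_le_mul_left h2 (by linarith)
    have h4 : 20 * N * n ≤ α * n * n := mul_le_mul_of_nonneg_right hsize (by linarith)
    have h5 : (5 * N) * (4 * n) ≤ (5 * N) * Real.log (d.choose D) := by linarith
    exact le_of_mul_le_mul_left h5 (by linarith)
  have hcard : (Finset.powersetCard D (Finset.univ : Finset (Fin d))).card = d.choose D := by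
    simp
  have hM : 16 ≤ d.choose D := by
    have hpos : (0 : ℝ) < d.choose D := by exact_mod_cast Nat.choose_pos hDd
    have h1 : Real.exp 4 ≤ d.choose D := by
      rw [← Real.exp_log hpos]
      exact Real.exp_le_exp.mpr (by linarith)
    have h2 : (16 : ℝ) ≤ Real.exp 4 := by
      have h3 : Real.exp 4 = Real.exp 1 ^ 4 := by rw [← Real.exp_nat_mul]; norm_num
      have h4 : (2 : ℝ) ≤ Real.exp 1 := by linarith [Real.exp_one_gt_d9]
      rw [h3]
      calc (16 : ℝ) = 2 ^ 4 := by norm_num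
        _ ≤ _ := by gcongr
    exact_mod_cast h2.trans h1
  obtain ⟨J, hJ, herr⟩ := exists_error_ge X (Finset.powersetCard D Finset.univ)
    (fun J => phiF (indicatorFreq J)) (hcard ▸ hM) (fun J _ => by
      rw [hcard]
      calc ∑ i, phiF (indicatorFreq J) (X i) ^ 2 ≤ ∑ _i : Fin n, (2 : ℝ) :=
            Finset.sum_le_sum fun i _ => phiF_sq_le _ _
        _ ≤ _ := by
            rw [Finset.sum_const, nsmul_eq_mul, Finset.card_univ, Fintype.card_fin]
            linarith) Jest
  have hJcard := (Finset.mem_powersetCard.mp hJ).2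
  have hJne : J.Nonempty := Finset.card_pos.mp (by omega)
  refine ⟨phiF (indicatorFreq J),
    memTildeSigma_phiF_indicatorFreq (h1L.trans hγL) hJne hJcard, ?_⟩
  rw [(sparsityPattern_phiF_indicatorFreq hJne).2]
  exact herr
end

section
/- Define φ(y) = ( Σ_{k ∈ ℤ} k² e^{−y k²} ) / ( Σ_{k ∈ ℤ} e^{−y k²} ) for y > 0. Then φ is continuous and strictly decreasing on (0,∞) (in particular φ'(y) < 0 for all y > 0), φ(y) → +∞ as y → 0⁺, and φ(y) → 0 as y → ∞. Consequently, for every γ > 0 there is a unique y_γ ∈ (0,∞) with φ(y_γ) = γ, and γ ↦ y_γ is strictly decreasing. -/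
open Real Set Filter

/-- `φ(y) = (Σ_{k ∈ ℤ} k² e^{−y k²}) / (Σ_{k ∈ ℤ} e^{−y k²})` for `y > 0`. -/
noncomputable def phiRatio (y : ℝ) : ℝ :=
  (∑' k : ℤ, ((k : ℝ)) ^ 2 * Real.exp (-y * ((k : ℝ)) ^ 2)) /
    (∑' k : ℤ, Real.exp (-y * ((k : ℝ)) ^ 2))

/-- The moment `Σ_{k ∈ ℤ} (k²)ⁿ e^{−y k²}` of the discrete Gaussian. -/
noncomputable def gaussMoment (n : ℕ) (y : ℝ) : ℝ :=
  ∑' k : ℤ, ((k : ℝ) ^ 2) ^ n * Real.exp (-y * (k : ℝ) ^ 2)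

lemma summable_gaussMoment (n : ℕ) {y : ℝ} (hy : 0 < y) :
    Summable fun k : ℤ => ((k : ℝ) ^ 2) ^ n * Real.exp (-y * (k : ℝ) ^ 2) := by
  have h := summable_pow_mul_jacobiTheta₂_term_bound 0 (div_pos hy Real.pi_pos) (2 * n)
  refine h.congr fun k => ?_
  rw [pow_mul, Int.cast_abs, sq_abs]
  congr 2
  field_simp
  ring

lemma phiRatio_eq (y : ℝ) : phiRatio y = gaussMoment 1 y / gaussMoment 0 y := by
  simp [phiRatio, gaussMoment]

lemma hasDerivAt_gaussMoment (n : ℕ) {y : ℝ} (hy : 0 < y) :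
    HasDerivAt (gaussMoment n) (-gaussMoment (n + 1) y) y := by
  have hmem : y ∈ Ioi (y / 2) := half_lt_self hy
  have h := hasDerivAt_tsum_of_isPreconnected
    (g := fun (k : ℤ) (x : ℝ) => ((k : ℝ) ^ 2) ^ n * Real.exp (-x * (k : ℝ) ^ 2))
    (g' := fun (k : ℤ) (x : ℝ) => -(((k : ℝ) ^ 2) ^ (n + 1) * Real.exp (-x * (k : ℝ) ^ 2)))
    (summable_gaussMoment (n + 1) (half_pos hy)) isOpen_Ioi isPreconnected_Ioi
    (fun k x _ => ?_) (fun k x hx => ?_) hmem (summable_gaussMoment n hy) hmem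
  · rwa [tsum_neg] at h
  · have h1 : HasDerivAt (fun x : ℝ => -x * (k : ℝ) ^ 2) (-1 * (k : ℝ) ^ 2) x :=
      (hasDerivAt_id x).neg.mul_const _
    convert! h1.exp.const_mul (((k : ℝ) ^ 2) ^ n) using 1
    ring
  · rw [norm_neg, Real.norm_of_nonneg (by positivity)]
    have : y / 2 < x := hx
    gcongr

lemma one_le_gaussMoment_zero {y : ℝ} (hy : 0 < y) : 1 ≤ gaussMoment 0 y := by
  simpa [gaussMoment] using (summable_gaussMoment 0 hy).sum_le_tsum {0} fun k _ => by positivity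

lemma gaussMoment_one_pos {y : ℝ} (hy : 0 < y) : 0 < gaussMoment 1 y :=
  (summable_gaussMoment 1 hy).tsum_pos (fun k => by positivity) 1 (by simp [Real.exp_pos])

/-- The strict Cauchy–Schwarz inequality for the moments. -/
lemma gaussMoment_one_sq_lt {y : ℝ} (hy : 0 < y) :
    gaussMoment 1 y ^ 2 < gaussMoment 2 y * gaussMoment 0 y := by
  have h0 := one_le_gaussMoment_zero hy
  have h1 := gaussMoment_one_pos hy
  set m := gaussMoment 1 y / gaussMoment 0 y with hm
  have hm0 : 0 < m := by positivity
  have hs : HasSum (fun k : ℤ => ((k : ℝ) ^ 2 - m) ^ 2 * Real.exp (-y * (k : ℝ) ^ 2))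
      (gaussMoment 2 y - 2 * m * gaussMoment 1 y + m ^ 2 * gaussMoment 0 y) := by
    convert! ((summable_gaussMoment 2 hy).hasSum.sub
      ((summable_gaussMoment 1 hy).hasSum.mul_left (2 * m))).add
      ((summable_gaussMoment 0 hy).hasSum.mul_left (m ^ 2)) using 2
    ring
  have hpos : 0 < gaussMoment 2 y - 2 * m * gaussMoment 1 y + m ^ 2 * gaussMoment 0 y := by
    rw [← hs.tsum_eq]
    exact hs.summable.tsum_pos (fun k => by positivity) 0 (by simp; positivity)
  have hmul : m * gaussMoment 0 y = gaussMoment 1 y := by rw [hm]; field_simp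
  rw [← hmul] at hpos ⊢
  nlinarith

lemma hasDerivAt_phiRatio {y : ℝ} (hy : 0 < y) :
    HasDerivAt phiRatio
      ((gaussMoment 1 y ^ 2 - gaussMoment 2 y * gaussMoment 0 y) / gaussMoment 0 y ^ 2) y := by
  have h0 := one_le_gaussMoment_zero hy
  rw [funext phiRatio_eq]
  convert! (hasDerivAt_gaussMoment 1 hy).div (hasDerivAt_gaussMoment 0 hy) (by positivity) using 2
  ring

lemma deriv_phiRatio_neg {y : ℝ} (hy : 0 < y) : deriv phiRatio y < 0 := by
  have h0 := one_le_gaussMoment_zero hy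
  rw [(hasDerivAt_phiRatio hy).deriv]
  exact div_neg_of_neg_of_pos (sub_neg.2 (gaussMoment_one_sq_lt hy)) (by positivity)

lemma continuousOn_phiRatio : ContinuousOn phiRatio (Ioi 0) :=
  fun _ hy => (hasDerivAt_phiRatio hy).continuousAt.continuousWithinAt

lemma strictAntiOn_phiRatio : StrictAntiOn phiRatio (Ioi 0) :=
  strictAntiOn_of_deriv_neg (convex_Ioi 0) continuousOn_phiRatio fun y hy =>
    deriv_phiRatio_neg (by simpa using hy)

lemma gaussMoment_one_le {y : ℝ} (hy : 1 ≤ y) :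
    gaussMoment 1 y ≤ Real.exp (1 - y) * gaussMoment 1 1 := by
  unfold gaussMoment
  rw [← tsum_mul_left]
  refine (summable_gaussMoment 1 (by linarith)).tsum_le_tsum (fun k => ?_)
    ((summable_gaussMoment 1 one_pos).mul_left _)
  rcases eq_or_ne k 0 with rfl | hk
  · simp
  have hk1 : (1 : ℝ) ≤ (k : ℝ) ^ 2 := by
    exact_mod_cast Int.add_one_le_iff.2 (sq_pos_of_ne_zero hk)
  rw [mul_left_comm, ← Real.exp_add]
  gcongr
  nlinarith

lemma tendsto_phiRatio_atTop : Tendsto phiRatio atTop (nhds 0) := by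
  have hlim : Tendsto (fun y : ℝ => Real.exp (1 - y) * gaussMoment 1 1) atTop (nhds 0) := by
    have h : Tendsto (fun y : ℝ => 1 - y) atTop atBot :=
      tendsto_atBot_add_const_left _ _ tendsto_neg_atTop_atBot
    simpa using (Real.tendsto_exp_atBot.comp h).mul_const (gaussMoment 1 1)
  refine squeeze_zero' ?_ ?_ hlim
  · filter_upwards [eventually_gt_atTop 0] with y hy
    have h0 := one_le_gaussMoment_zero hy
    have h1 := gaussMoment_one_pos hy
    rw [phiRatio_eq]
    positivity
  · filter_upwards [eventually_ge_atTop 1] with y hy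
    have hy0 : 0 < y := by linarith
    rw [phiRatio_eq]
    exact (div_le_self (gaussMoment_one_pos hy0).le (one_le_gaussMoment_zero hy0)).trans
      (gaussMoment_one_le hy)

lemma sum_range_sq_sub (c : ℝ) (n : ℕ) :
    ∑ k ∈ Finset.range (n + 1), ((k : ℝ) ^ 2 - c) = (n + 1) * (n * (2 * n + 1) / 6 - c) := by
  induction n with
  | zero => simp
  | succ n ih => rw [Finset.sum_range_succ, ih]; push_cast; ring

lemma sum_Icc_sq_sub (c : ℝ) (n : ℕ) :
    ∑ k ∈ Finset.Icc (-n : ℤ) n, ((k : ℝ) ^ 2 - c) = (2 * n + 1) * (n * (n + 1) / 3 - c) := by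
  rw [Finset.sum_Icc_of_even_eq_range (f := fun k : ℤ => (k : ℝ) ^ 2 - c) (fun k => by simp)]
  simp only [Int.cast_natCast, sum_range_sq_sub, nsmul_eq_mul]
  push_cast
  ring

lemma tendsto_phiRatio_nhdsGT_zero : Tendsto phiRatio (nhdsWithin 0 (Ioi 0)) atTop := by
  refine tendsto_atTop.2 fun c => ?_
  obtain ⟨N, hN⟩ := exists_nat_gt (max c 1)
  obtain ⟨hc, hN1⟩ := max_lt_iff.1 hN
  set S := Finset.Icc (-(3 * N : ℕ) : ℤ) (3 * N : ℕ) with hS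
  have hcont : Continuous fun y : ℝ =>
      ∑ k ∈ S, ((k : ℝ) ^ 2 - c) * Real.exp (-y * (k : ℝ) ^ 2) := by fun_prop
  have hpos : 0 < ∑ k ∈ S, ((k : ℝ) ^ 2 - c) * Real.exp (-0 * (k : ℝ) ^ 2) := by
    simp only [neg_zero, zero_mul, Real.exp_zero, mul_one]
    rw [hS, sum_Icc_sq_sub]
    push_cast
    exact mul_pos (by positivity) (by nlinarith)
  filter_upwards [nhdsWithin_le_nhds (hcont.continuousAt.eventually_const_lt hpos),
    self_mem_nhdsWithin] with y hSy hy
  have hy : 0 < y := hy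
  have h0 := one_le_gaussMoment_zero hy
  have hs : HasSum (fun k : ℤ => ((k : ℝ) ^ 2 - c) * Real.exp (-y * (k : ℝ) ^ 2))
      (gaussMoment 1 y - c * gaussMoment 0 y) := by
    convert! (summable_gaussMoment 1 hy).hasSum.sub
      ((summable_gaussMoment 0 hy).hasSum.mul_left c) using 2
    ring
  have hle := sum_le_hasSum S (fun k hk => ?_) hs
  · rw [phiRatio_eq, le_div_iff₀ (by positivity)]
    linarith
  · refine mul_nonneg (sub_nonneg.2 ?_) (Real.exp_pos _).le
    have hk' : (3 * N : ℤ) < |k| := by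
      by_contra! hcon
      exact hk (by rw [hS, Finset.mem_Icc, ← abs_le]; exact_mod_cast hcon)
    have hk'' : (3 * N : ℝ) < |(k : ℝ)| := by exact_mod_cast hk'
    rw [← sq_abs]
    nlinarith

lemma existsUnique_phiRatio_eq {γ : ℝ} (hγ : 0 < γ) :
    ∃! y : ℝ, y ∈ Ioi (0 : ℝ) ∧ phiRatio y = γ := by
  obtain ⟨a, ha, ha0⟩ := ((tendsto_phiRatio_nhdsGT_zero.eventually_ge_atTop γ).and
    self_mem_nhdsWithin).exists
  obtain ⟨b, hb, hb0⟩ := ((tendsto_phiRatio_atTop.eventually_le_const hγ).and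
    (eventually_gt_atTop 0)).exists
  obtain ⟨y, hy, rfl⟩ := isPreconnected_Ioi.intermediate_value (mem_Ioi.2 hb0) ha0
    continuousOn_phiRatio ⟨hb, ha⟩
  exact ⟨y, ⟨hy, rfl⟩, fun z hz => strictAntiOn_phiRatio.injOn hz.1 hy hz.2⟩

/-- `φ` is continuous and strictly decreasing on `(0,∞)` (with `φ' < 0`),
`φ(y) → +∞` as `y → 0⁺`, `φ(y) → 0` as `y → ∞`; hence for every `γ > 0` there is a unique
`y_γ > 0` with `φ(y_γ) = γ`, and `γ ↦ y_γ` is strictly decreasing. -/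
theorem phiRatio_properties :
    ContinuousOn phiRatio (Set.Ioi 0) ∧
    StrictAntiOn phiRatio (Set.Ioi 0) ∧
    (∀ y : ℝ, 0 < y → deriv phiRatio y < 0) ∧
    Filter.Tendsto phiRatio (nhdsWithin 0 (Set.Ioi 0)) Filter.atTop ∧
    Filter.Tendsto phiRatio Filter.atTop (nhds 0) ∧
    (∀ γ : ℝ, 0 < γ → ∃! y : ℝ, y ∈ Set.Ioi (0 : ℝ) ∧ phiRatio y = γ) ∧
    ∀ ysel : ℝ → ℝ,
      (∀ γ : ℝ, 0 < γ → ysel γ ∈ Set.Ioi (0 : ℝ) ∧ phiRatio (ysel γ) = γ) →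
      StrictAntiOn ysel (Set.Ioi 0) := by
  refine ⟨continuousOn_phiRatio, strictAntiOn_phiRatio, fun y => deriv_phiRatio_neg,
    tendsto_phiRatio_nhdsGT_zero, tendsto_phiRatio_atTop, fun γ => existsUnique_phiRatio_eq,
    fun ysel hsel a ha b hb hab => ?_⟩
  refine (strictAntiOn_phiRatio.lt_iff_gt (hsel a ha).1 (hsel b hb).1).1 ?_
  rwa [(hsel a ha).2, (hsel b hb).2]
end

section
/- Let d and d* be integers with 1 ≤ d* ≤ d and let m ≥ 1 be a real number. Then the cardinality of S_{m,d*} = { k ∈ ℤ^d : ‖k‖₂ ≤ m and ‖k‖₀ ≤ d* } satisfies Card(S_{m,d*}) ≤ Σ_{i=0}^{d*} C(d,i) (2m)^i ≤ 3 (2md)^{d*} ≤ (6md)^{d*}, where C(d,i) denotes the binomial coefficient. -/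
open Real Set

/-- Integer vectors supported exactly on `A` with entries bounded by `M` in absolute value. -/
noncomputable def boxWithSupport {d : ℕ} (M : ℕ) (A : Finset (Fin d)) : Finset (Fin d → ℤ) :=
  Fintype.piFinset fun i => if i ∈ A then (Finset.Icc (-(M : ℤ)) M).erase 0 else {0}

theorem card_boxWithSupport {d : ℕ} (M : ℕ) (A : Finset (Fin d)) :
    (boxWithSupport M A).card = (2 * M) ^ A.card := by
  have hM : ((Finset.Icc (-(M : ℤ)) M).erase 0).card = 2 * M := by
    rw [Finset.card_erase_of_mem (by simp), Int.card_Icc]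
    omega
  simp only [boxWithSupport, Fintype.card_piFinset, apply_ite Finset.card, hM,
    Finset.card_singleton]
  simp

theorem sparseBall_subset_biUnion (d : ℕ) {m : ℝ} (hm : 0 ≤ m) (ℓ : ℕ) :
    sparseBall d m ℓ ⊆ ((Finset.range (ℓ + 1)).biUnion fun i =>
      (Finset.powersetCard i (Finset.univ : Finset (Fin d))).biUnion
        (boxWithSupport ⌊m⌋₊) : Finset (Fin d → ℤ)) := by
  rintro k ⟨hk, hcard⟩
  have hbound (i : Fin d) : |k i| ≤ (⌊m⌋₊ : ℤ) := by
    have hle : |(k i : ℝ)| ≤ m :=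
      (Real.abs_le_sqrt (Finset.single_le_sum (f := fun j => (k j : ℝ) ^ 2)
        (fun j _ => sq_nonneg _) (Finset.mem_univ i))).trans hk
    rw [Int.natCast_floor_eq_floor hm]
    exact Int.le_floor.2 (by simpa using hle)
  simp only [Finset.mem_coe, Finset.mem_biUnion, Finset.mem_range, Finset.mem_powersetCard]
  refine ⟨_, Nat.lt_succ_of_le hcard, _, ⟨Finset.subset_univ _, rfl⟩, ?_⟩
  rw [boxWithSupport, Fintype.mem_piFinset]
  intro i
  by_cases hi : k i = 0
  · simp [hi]
  · simpa [hi] using abs_le.1 (hbound i)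

theorem ncard_sparseBall_le_sum (d : ℕ) {m : ℝ} (hm : 0 ≤ m) (ℓ : ℕ) :
    ((sparseBall d m ℓ).ncard : ℝ)
      ≤ ∑ i ∈ Finset.range (ℓ + 1), (d.choose i : ℝ) * (2 * m) ^ i := by
  have hnat : (sparseBall d m ℓ).ncard
      ≤ ∑ i ∈ Finset.range (ℓ + 1), d.choose i * (2 * ⌊m⌋₊) ^ i := by
    refine (Set.ncard_le_ncard (sparseBall_subset_biUnion d hm ℓ)
      (Finset.finite_toSet _)).trans ?_
    rw [Set.ncard_coe_finset]
    refine Finset.card_biUnion_le.trans (Finset.sum_le_sum fun i _ => ?_)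
    refine (Finset.card_biUnion_le_card_mul _ _ ((2 * ⌊m⌋₊) ^ i) fun A hA => ?_).trans ?_
    · rw [card_boxWithSupport, (Finset.mem_powersetCard.1 hA).2]
    · simp
  calc ((sparseBall d m ℓ).ncard : ℝ)
      ≤ ∑ i ∈ Finset.range (ℓ + 1), (d.choose i : ℝ) * (2 * (⌊m⌋₊ : ℝ)) ^ i := by
        exact_mod_cast hnat
    _ ≤ _ := by
        gcongr
        exact Nat.floor_le hm

theorem sum_choose_mul_pow_le (d ℓ : ℕ) {x : ℝ} (hx : 0 ≤ x) (hxd : 1 ≤ x * d) :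
    ∑ i ∈ Finset.range (ℓ + 1), (d.choose i : ℝ) * x ^ i ≤ 3 * (x * d) ^ ℓ := by
  have hexp : ∑ i ∈ Finset.range (ℓ + 1), (1 : ℝ) / (i.factorial : ℝ) ≤ 3 := by
    have h := Real.sum_le_exp_of_nonneg zero_le_one (ℓ + 1)
    simp only [one_pow] at h
    linarith [Real.exp_one_lt_d9]
  calc ∑ i ∈ Finset.range (ℓ + 1), (d.choose i : ℝ) * x ^ i
      ≤ ∑ i ∈ Finset.range (ℓ + 1), 1 / (i.factorial : ℝ) * (x * d) ^ ℓ := by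
        refine Finset.sum_le_sum fun i hi => ?_
        calc (d.choose i : ℝ) * x ^ i
            ≤ ((d : ℝ) ^ i / (i.factorial : ℝ)) * x ^ i := by
              gcongr
              exact Nat.choose_le_pow_div i d
          _ = 1 / (i.factorial : ℝ) * (x * d) ^ i := by
              rw [mul_pow]
              ring
          _ ≤ 1 / (i.factorial : ℝ) * (x * d) ^ ℓ := by
              gcongr
              exact Nat.lt_succ_iff.1 (Finset.mem_range.1 hi)
    _ ≤ 3 * (x * d) ^ ℓ := by
        rw [← Finset.sum_mul]
        gcongr

/-- For `1 ≤ d* ≤ d` and `m ≥ 1`,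
`Card(S_{m,d*}) ≤ Σ_{i=0}^{d*} C(d,i) (2m)^i ≤ 3 (2md)^{d*} ≤ (6md)^{d*}`. -/
theorem card_sparseBall_le (d dstar : ℕ) (h1 : 1 ≤ dstar) (h2 : dstar ≤ d)
    (m : ℝ) (hm : 1 ≤ m) :
    ((sparseBall d m dstar).ncard : ℝ)
        ≤ ∑ i ∈ Finset.range (dstar + 1), (d.choose i : ℝ) * (2 * m) ^ i ∧
    (∑ i ∈ Finset.range (dstar + 1), (d.choose i : ℝ) * (2 * m) ^ i)
        ≤ 3 * (2 * m * d) ^ dstar ∧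
    3 * (2 * m * d) ^ dstar ≤ (6 * m * d) ^ dstar := by
  have hd : (1 : ℝ) ≤ d := by exact_mod_cast h1.trans h2
  refine ⟨ncard_sparseBall_le_sum d (by linarith) dstar,
    sum_choose_mul_pow_le d dstar (by linarith) (by nlinarith), ?_⟩
  calc 3 * (2 * m * d) ^ dstar ≤ 3 ^ dstar * (2 * m * d) ^ dstar := by
        gcongr
        exact le_self_pow₀ (by norm_num) (by omega)
    _ = (6 * m * d) ^ dstar := by
        rw [← mul_pow]
        ring
end
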